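/- arXiv:2310.03070 — 5 statements merged into one kernel-verified Lean document; each statement's English description precedes it below -/
import Mathlib

section
/- Noether (Bianchi-type) identity for the noncommutative field equations: Σ_{c=0}^{3} D_c ψ^c = 0, i.e. the covariant divergence of the field-equation expression vanishes identically for every gauge potential A. -/
open Complex

namespace NC

/-- Commutator in an associative algebra. -/
def br {𝔄 : Type*} [Ring 𝔄] (X Y : 𝔄) : 𝔄 := X * Y - Y * X

/-- Minkowski metric diag(-1,1,1,1), as a family of scalars. -/
def η : Fin 4 → ℂ := fun a => if a = 0 then -1 else 1

variable {𝔄 : Type*} [Ring 𝔄] [Algebra ℂ 𝔄]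

/-- Field strength F_{ab} = ∂_a A_b - ∂_b A_a - i [A_a, A_b]. -/
def F (d : Fin 4 → 𝔄 →ₗ[ℂ] 𝔄) (A : Fin 4 → 𝔄) (a b : Fin 4) : 𝔄 :=
  d a (A b) - d b (A a) - I • br (A a) (A b)

/-- Field strength with both indices raised: F^{ac} = η^{aa} η^{cc} F_{ac}. -/
def Fup (d : Fin 4 → 𝔄 →ₗ[ℂ] 𝔄) (A : Fin 4 → 𝔄) (a c : Fin 4) : 𝔄 :=
  (η a * η c) • F d A a c

/-- Covariant derivative D_a X = ∂_a X - i [A_a, X]. -/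
def D (d : Fin 4 → 𝔄 →ₗ[ℂ] 𝔄) (A : Fin 4 → 𝔄) (a : Fin 4) (X : 𝔄) : 𝔄 :=
  d a X - I • br (A a) X

/-- Wave operator □X = Σ_a ∂^a (∂_a X). -/
def box (d : Fin 4 → 𝔄 →ₗ[ℂ] 𝔄) (X : 𝔄) : 𝔄 :=
  ∑ a : Fin 4, η a • d a (d a X)

/-- Nonlinear current Λ^c = -i Σ_a ∂_a [A^a, A^c] - i Σ_a [A_a, F^{ac}]. -/
def Λ (d : Fin 4 → 𝔄 →ₗ[ℂ] 𝔄) (A : Fin 4 → 𝔄) (c : Fin 4) : 𝔄 :=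
  (-I) • ∑ a : Fin 4, d a (br (η a • A a) (η c • A c))
    - I • ∑ a : Fin 4, br (A a) (Fup d A a c)

/-- Field-equation expression ψ^c = □A^c - ∂^c(Σ_a ∂_a A^a) + Λ^c. -/
def ψ (d : Fin 4 → 𝔄 →ₗ[ℂ] 𝔄) (A : Fin 4 → 𝔄) (c : Fin 4) : 𝔄 :=
  box d (η c • A c) - η c • d c (∑ a : Fin 4, d a (η a • A a)) + Λ d A c

/-- Explicit first-order gauge variation of Λ^c under δA_a = D_a ε,
    with δF^{ac} = -i [F^{ac}, ε] substituted. -/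
def δΛ (d : Fin 4 → 𝔄 →ₗ[ℂ] 𝔄) (A : Fin 4 → 𝔄) (ε : 𝔄) (c : Fin 4) : 𝔄 :=
  (-I) • ∑ a : Fin 4,
      d a (br (η a • D d A a ε) (η c • A c) + br (η a • A a) (η c • D d A c ε))
    - I • ∑ a : Fin 4,
      (br (D d A a ε) (Fup d A a c) + br (A a) ((-I) • br (Fup d A a c) ε))

theorem br_smul_left (r : ℂ) (X Y : 𝔄) : br (r • X) Y = r • br X Y := by
  simp [br, smul_sub]

theorem br_smul_right (r : ℂ) (X Y : 𝔄) : br X (r • Y) = r • br X Y := by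
  simp [br, smul_sub]

theorem D_smul (d : Fin 4 → 𝔄 →ₗ[ℂ] 𝔄) (A : Fin 4 → 𝔄) (a : Fin 4) (r : ℂ) (X : 𝔄) :
    D d A a (r • X) = r • D d A a X := by
  simp only [D, br_smul_right, map_smul, smul_sub, smul_comm I r]

theorem D_sum {ι : Type*} (d : Fin 4 → 𝔄 →ₗ[ℂ] 𝔄) (A : Fin 4 → 𝔄) (a : Fin 4)
    (s : Finset ι) (f : ι → 𝔄) : D d A a (∑ i ∈ s, f i) = ∑ i ∈ s, D d A a (f i) := by
  simp only [D, br, map_sum, Finset.mul_sum, Finset.sum_mul, Finset.smul_sum,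
    ← Finset.sum_sub_distrib]

theorem F_antisymm (d : Fin 4 → 𝔄 →ₗ[ℂ] 𝔄) (A : Fin 4 → 𝔄) (a b : Fin 4) :
    F d A a b = -F d A b a := by
  simp only [F, br, smul_sub]
  abel

theorem D_D_sub_D_D (d : Fin 4 → 𝔄 →ₗ[ℂ] 𝔄)
    (hLeib : ∀ (a : Fin 4) (x y : 𝔄), d a (x * y) = d a x * y + x * d a y)
    (hComm : ∀ (a b : Fin 4) (x : 𝔄), d a (d b x) = d b (d a x))
    (A : Fin 4 → 𝔄) (a b : Fin 4) (X : 𝔄) :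
    D d A a (D d A b X) - D d A b (D d A a X) = -(I • br (F d A a b) X) := by
  simp only [D, F, br, map_sub, map_smul, hLeib, hComm a b X, smul_sub, smul_add, mul_sub,
    sub_mul, mul_smul_comm, smul_mul_assoc, smul_smul, mul_assoc]
  abel

/-- The field-equation expression is the covariant divergence of the field strength. -/
theorem ψ_eq_sum_D_Fup (d : Fin 4 → 𝔄 →ₗ[ℂ] 𝔄)
    (hComm : ∀ (a b : Fin 4) (x : 𝔄), d a (d b x) = d b (d a x))
    (A : Fin 4 → 𝔄) (c : Fin 4) : ψ d A c = ∑ a : Fin 4, D d A a (Fup d A a c) := by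
  simp only [ψ, box, Λ, map_sum, Finset.smul_sum, ← Finset.sum_sub_distrib,
    ← Finset.sum_add_distrib]
  refine Finset.sum_congr rfl fun a _ => ?_
  simp only [D, Fup, F, br_smul_left, br_smul_right, map_sub, map_smul, hComm c a (A a)]
  module

theorem sum_D_D_Fup_eq_zero (d : Fin 4 → 𝔄 →ₗ[ℂ] 𝔄)
    (hLeib : ∀ (a : Fin 4) (x y : 𝔄), d a (x * y) = d a x * y + x * d a y)
    (hComm : ∀ (a b : Fin 4) (x : 𝔄), d a (d b x) = d b (d a x))
    (A : Fin 4 → 𝔄) :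
    ∑ c : Fin 4, ∑ a : Fin 4, D d A c (D d A a (Fup d A a c)) = 0 := by
  have pair (c a : Fin 4) :
      D d A c (D d A a (Fup d A a c)) + D d A a (D d A c (Fup d A c a)) = 0 := by
    have anti : Fup d A c a = (-(η a * η c)) • F d A a c := by
      rw [Fup, F_antisymm, mul_comm (η c), smul_neg, neg_smul]
    rw [anti, Fup]
    simp only [D_smul]
    rw [neg_smul, ← sub_eq_add_neg, ← smul_sub, D_D_sub_D_D d hLeib hComm, F_antisymm d A c a]
    simp [br]
  refine (smul_eq_zero_iff_right (two_ne_zero : (2 : ℂ) ≠ 0)).mp ?_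
  rw [two_smul]
  nth_rewrite 2 [Finset.sum_comm]
  simp only [← Finset.sum_add_distrib, pair, Finset.sum_const_zero]

/-- Noether (Bianchi-type) identity: Σ_c D_c ψ^c = 0. -/
theorem covariant_divergence_of_field_equations {𝔄 : Type*} [Ring 𝔄] [Algebra ℂ 𝔄]
    (d : Fin 4 → 𝔄 →ₗ[ℂ] 𝔄)
    (hLeib : ∀ (a : Fin 4) (x y : 𝔄), d a (x * y) = d a x * y + x * d a y)
    (hComm : ∀ (a b : Fin 4) (x : 𝔄), d a (d b x) = d b (d a x))
    (A : Fin 4 → 𝔄) :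
    ∑ c : Fin 4, D d A c (ψ d A c) = 0 := by
  simp only [ψ_eq_sum_D_Fup d hComm, D_sum]
  exact sum_D_D_Fup_eq_zero d hLeib hComm A

end NC
end

section
/- Divergence of the nonlinear current equals a commutator with the field equations: for every gauge potential A, Σ_{a=0}^{3} ∂_a Λ^a = i Σ_{a=0}^{3} [A_a, ψ^a]. -/
open Complex

namespace NC

variable {𝔄 : Type*} [Ring 𝔄] [Algebra ℂ 𝔄]

/-- A double sum whose summand is antisymmetric in its two indices vanishes. -/
theorem sum_sum_eq_zero_of_antisymm {ι M : Type*} [Fintype ι] [AddCommGroup M] [Module ℂ M]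
    (f : ι → ι → M) (hf : ∀ a c, f a c + f c a = 0) : ∑ c, ∑ a, f a c = 0 := by
  have h : ∑ c, ∑ a, f a c + ∑ c, ∑ a, f a c = 0 := by
    nth_rewrite 2 [Finset.sum_comm]
    simp [← Finset.sum_add_distrib, hf]
  have h2 : (2 : ℂ) • ∑ c, ∑ a, f a c = 0 := by rw [two_smul, h]
  exact (smul_eq_zero.mp h2).resolve_left two_ne_zero

theorem br_add_right {R : Type*} [Ring R] (x y z : R) : br x (y + z) = br x y + br x z := by
  simp only [br]; noncomm_ring

theorem br_sub_right {R : Type*} [Ring R] (x y z : R) : br x (y - z) = br x y - br x z := by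
  simp only [br]; noncomm_ring

theorem br_smul_right_s5 (k : ℂ) (x y : 𝔄) : br x (k • y) = k • br x y := by
  simp only [br, mul_smul_comm, smul_mul_assoc, smul_sub]

theorem br_sum_right {R ι : Type*} [Ring R] (s : Finset ι) (x : R) (f : ι → R) :
    br x (∑ i ∈ s, f i) = ∑ i ∈ s, br x (f i) := by
  simp only [br, Finset.mul_sum, Finset.sum_mul, Finset.sum_sub_distrib]

/-- Divergence of the nonlinear current: Σ_a ∂_a Λ^a = i Σ_a [A_a, ψ^a]. -/
theorem divergence_of_current {𝔄 : Type*} [Ring 𝔄] [Algebra ℂ 𝔄]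
    (d : Fin 4 → 𝔄 →ₗ[ℂ] 𝔄)
    (hLeib : ∀ (a : Fin 4) (x y : 𝔄), d a (x * y) = d a x * y + x * d a y)
    (hComm : ∀ (a b : Fin 4) (x : 𝔄), d a (d b x) = d b (d a x))
    (A : Fin 4 → 𝔄) :
    ∑ a : Fin 4, d a (Λ d A a) = I • ∑ a : Fin 4, br (A a) (ψ d A a) := by
  rw [← sub_eq_zero]
  simp only [ψ, Λ, box, br_add_right, br_sub_right, br_smul_right_s5, br_sum_right, map_sum, map_sub,
    map_smul, Finset.smul_sum, ← Finset.sum_sub_distrib, ← Finset.sum_add_distrib]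
  refine sum_sum_eq_zero_of_antisymm _ fun a c => ?_
  have h (x : 𝔄) : d c (d a x) = d a (d c x) := hComm c a x
  simp only [Fup, F, br, map_sub, map_add, map_smul, hLeib, h, mul_sub, sub_mul, mul_add, add_mul,
    smul_sub, smul_add, smul_mul_assoc, mul_smul_comm, smul_smul, mul_assoc]
  module

end NC
end

section
/- Main identity for the gauge variation of the nonlinear current: for every ε ∈ 𝔄 and each index a ∈ {0,1,2,3}, i · δΛ^a = □[ε, A^a] − ∂^a( Σ_{c=0}^{3} ∂_c[ε, A^c] ) − [ε, ψ^a], where δΛ^c denotes the explicit first-order variation of Λ^c under δA_a = D_a ε, namely δΛ^c := −i Σ_{a=0}^{3} ∂_a( [D^a ε, A^c] + [A^a, D^c ε] ) − i Σ_{a=0}^{3} ( [D_a ε, F^{ac}] + [A_a, −i[F^{ac}, ε]] ). -/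
open Complex

namespace NC

variable {𝔄 : Type*} [Ring 𝔄] [Algebra ℂ 𝔄]

/-- Main identity for the gauge variation of the nonlinear current:
    i·δΛ^a = □[ε, A^a] - ∂^a(Σ_c ∂_c[ε, A^c]) - [ε, ψ^a]. -/
theorem gauge_variation_of_current {𝔄 : Type*} [Ring 𝔄] [Algebra ℂ 𝔄]
    (d : Fin 4 → 𝔄 →ₗ[ℂ] 𝔄)
    (hLeib : ∀ (a : Fin 4) (x y : 𝔄), d a (x * y) = d a x * y + x * d a y)
    (hComm : ∀ (a b : Fin 4) (x : 𝔄), d a (d b x) = d b (d a x))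
    (A : Fin 4 → 𝔄) (ε : 𝔄) (a : Fin 4) :
    I • δΛ d A ε a
      = box d (br ε (η a • A a))
          - η a • d a (∑ c : Fin 4, d c (br ε (η c • A c)))
          - br ε (ψ d A a) := by
  simp only [δΛ, ψ, Λ, box]
  have br_sum (f : Fin 4 → 𝔄) : br ε (∑ c, f c) = ∑ c, br ε (f c) := by
    simp only [br, Finset.mul_sum, Finset.sum_mul, Finset.sum_sub_distrib]
  have br_add (x y : 𝔄) : br ε (x + y) = br ε x + br ε y := by
    simp only [br]; noncomm_ring
  have br_sub (x y : 𝔄) : br ε (x - y) = br ε x - br ε y := by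
    simp only [br]; noncomm_ring
  have br_smul (r : ℂ) (x : 𝔄) : br ε (r • x) = r • br ε x := by
    simp only [br, mul_smul_comm, smul_mul_assoc, smul_sub]
  simp only [br_add, br_sub, map_sum, Finset.smul_sum, br_sum, br_smul,
    ← Finset.sum_sub_distrib, ← Finset.sum_add_distrib]
  refine Finset.sum_congr rfl fun c _ => ?_
  simp only [br, Fup, F, D, map_add, map_sub, map_smul, hLeib, hComm c a, mul_add, add_mul,
    mul_sub, sub_mul, mul_smul_comm, smul_mul_assoc, mul_assoc]
  match_scalars <;> ring_nf <;> simp only [I_sq, I_pow_three, I_pow_four] <;> ring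

end NC
end

section
/- Wave-operator form of the gauge transformation law (□-multiplied version of equation (SWM4)): for every ε ∈ 𝔄 and each index a ∈ {0,1,2,3}, □(D_a ε) + δΛ_a = ∂_a( □ε + i Σ_{c=0}^{3} ∂_c[ε, A^c] ) + i [ε, ψ_a], where δΛ_a := η_{aa} δΛ^a and ψ_a := η_{aa} ψ^a, and δΛ^c is the explicit first-order variation of Λ^c under δA_a = D_a ε, namely δΛ^c := −i Σ_{a=0}^{3} ∂_a( [D^a ε, A^c] + [A^a, D^c ε] ) − i Σ_{a=0}^{3} ( [D_a ε, F^{ac}] + [A_a, −i[F^{ac}, ε]] ). -/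
open Complex

namespace NC

variable {𝔄 : Type*} [Ring 𝔄] [Algebra ℂ 𝔄]

lemma η_mul_self (a : Fin 4) : η a * η a = 1 := by
  unfold η
  split_ifs <;> norm_num

/-- The contribution of a single summation index `b` to `swm4_box_form`. -/
lemma box_form_summand {𝔄 : Type*} [Ring 𝔄] [Algebra ℂ 𝔄]
    (d : Fin 4 → 𝔄 →ₗ[ℂ] 𝔄)
    (hLeib : ∀ (a : Fin 4) (x y : 𝔄), d a (x * y) = d a x * y + x * d a y)
    (hComm : ∀ (a b : Fin 4) (x : 𝔄), d a (d b x) = d b (d a x))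
    (A : Fin 4 → 𝔄) (ε : 𝔄) (a b : Fin 4) :
    η b • d b (d b (D d A a ε)) + η a • ((-I) • d b
          (br (η b • D d A b ε) (η a • A a) + br (η b • A b) (η a • D d A a ε))
        - I • (br (D d A b ε) (Fup d A b a) + br (A b) ((-I) • br (Fup d A b a) ε)))
      = d a (η b • d b (d b ε) + I • d b (br ε (η b • A b)))
        + I • br ε (η a • (η b • d b (d b (η a • A a)) - η a • d a (d b (η b • A b))
          + ((-I) • d b (br (η b • A b) (η a • A a)) - I • br (A b) (Fup d A b a)))) := by
  have hη := η_mul_self a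
  simp only [D, F, Fup, br, map_add, map_sub, map_smul, hLeib, smul_mul_assoc, mul_smul_comm,
    mul_add, add_mul, mul_sub, sub_mul, mul_assoc, hComm a b]
  generalize η a = s at *
  generalize η b = t at *
  match_scalars <;> grind [I_mul_I]

/-- Wave-operator form of equation (SWM4):
    □(D_a ε) + δΛ_a = ∂_a(□ε + i Σ_c ∂_c[ε, A^c]) + i [ε, ψ_a]. -/
theorem swm4_box_form {𝔄 : Type*} [Ring 𝔄] [Algebra ℂ 𝔄]
    (d : Fin 4 → 𝔄 →ₗ[ℂ] 𝔄)
    (hLeib : ∀ (a : Fin 4) (x y : 𝔄), d a (x * y) = d a x * y + x * d a y)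
    (hComm : ∀ (a b : Fin 4) (x : 𝔄), d a (d b x) = d b (d a x))
    (A : Fin 4 → 𝔄) (ε : 𝔄) (a : Fin 4) :
    box d (D d A a ε) + η a • δΛ d A ε a
      = d a (box d ε + I • ∑ c : Fin 4, d c (br ε (η c • A c)))
          + I • br ε (η a • ψ d A a) := by
  have h := Finset.sum_congr rfl fun b (_ : b ∈ Finset.univ) =>
    box_form_summand d hLeib hComm A ε a b
  have hbr (s : Fin 4 → 𝔄) : br ε (∑ b, s b) = ∑ b, br ε (s b) := by
    simp only [br, Finset.mul_sum, Finset.sum_mul, Finset.sum_sub_distrib]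
  simp only [box, δΛ, ψ, Λ, map_sum, Finset.smul_sum, ← Finset.sum_add_distrib,
    ← Finset.sum_sub_distrib, hbr]
  exact h

end NC
end

section
/- Gauge covariance of the noncommutative field equations: for every ε ∈ 𝔄 and each index c ∈ {0,1,2,3}, the first-order variation of ψ^c under the gauge transformation δA_a = D_a ε, namely δψ^c := □(D^c ε) − ∂^c( Σ_{a=0}^{3} ∂_a(D^a ε) ) + δΛ^c, satisfies δψ^c = i [ε, ψ^c], where δΛ^c := −i Σ_{a=0}^{3} ∂_a( [D^a ε, A^c] + [A^a, D^c ε] ) − i Σ_{a=0}^{3} ( [D_a ε, F^{ac}] + [A_a, −i[F^{ac}, ε]] ). -/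
open Complex

namespace NC

variable {𝔄 : Type*} [Ring 𝔄] [Algebra ℂ 𝔄]

/-- The summand over `a` of the gauge covariance identity, with the metric factored out. -/
theorem gauge_covariance_summand (d : Fin 4 → 𝔄 →ₗ[ℂ] 𝔄)
    (hLeib : ∀ (a : Fin 4) (x y : 𝔄), d a (x * y) = d a x * y + x * d a y)
    (hComm : ∀ (a b : Fin 4) (x : 𝔄), d a (d b x) = d b (d a x))
    (A : Fin 4 → 𝔄) (ε : 𝔄) (a c : Fin 4) :
    d a (d a (D d A c ε)) - d c (d a (D d A a ε))
        - I • d a (br (D d A a ε) (A c) + br (A a) (D d A c ε))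
        - I • (br (D d A a ε) (F d A a c) + br (A a) ((-I) • br (F d A a c) ε))
      = I • br ε (d a (d a (A c)) - d c (d a (A a)) - I • d a (br (A a) (A c))
        - I • br (A a) (F d A a c)) := by
  simp only [D, F, br, map_sub, map_add, map_smul, hLeib, mul_sub, sub_mul, mul_add, add_mul,
    smul_mul_assoc, mul_smul_comm, mul_assoc, hComm c a]
  module

/-- Gauge covariance of the field equations:
    δψ^c = □(D^c ε) - ∂^c(Σ_a ∂_a(D^a ε)) + δΛ^c = i [ε, ψ^c]. -/
theorem gauge_covariance_of_field_equations {𝔄 : Type*} [Ring 𝔄] [Algebra ℂ 𝔄]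
    (d : Fin 4 → 𝔄 →ₗ[ℂ] 𝔄)
    (hLeib : ∀ (a : Fin 4) (x y : 𝔄), d a (x * y) = d a x * y + x * d a y)
    (hComm : ∀ (a b : Fin 4) (x : 𝔄), d a (d b x) = d b (d a x))
    (A : Fin 4 → 𝔄) (ε : 𝔄) (c : Fin 4) :
    box d (η c • D d A c ε)
        - η c • d c (∑ a : Fin 4, d a (η a • D d A a ε))
        + δΛ d A ε c
      = I • br ε (ψ d A c) := by
  have lhs : box d (η c • D d A c ε) - η c • d c (∑ a : Fin 4, d a (η a • D d A a ε))
      + δΛ d A ε c = ∑ a : Fin 4, (η a * η c) • (d a (d a (D d A c ε)) - d c (d a (D d A a ε))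
        - I • d a (br (D d A a ε) (A c) + br (A a) (D d A c ε))
        - I • (br (D d A a ε) (F d A a c) + br (A a) ((-I) • br (F d A a c) ε))) := by
    simp only [box, δΛ, map_sum, Finset.smul_sum, ← Finset.sum_sub_distrib,
      ← Finset.sum_add_distrib]
    refine Finset.sum_congr rfl fun a _ => ?_
    simp only [Fup, br, map_smul, map_sub, map_add, smul_mul_assoc, mul_smul_comm, mul_sub, sub_mul]
    module
  have rhs : ψ d A c = ∑ a : Fin 4, (η a * η c) • (d a (d a (A c)) - d c (d a (A a))
        - I • d a (br (A a) (A c)) - I • br (A a) (F d A a c)) := by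
    simp only [ψ, box, Λ, map_sum, Finset.smul_sum, ← Finset.sum_sub_distrib,
      ← Finset.sum_add_distrib]
    refine Finset.sum_congr rfl fun a _ => ?_
    simp only [Fup, br, map_smul, map_sub, smul_mul_assoc, mul_smul_comm]
    module
  rw [lhs, rhs, br, Finset.mul_sum, Finset.sum_mul, ← Finset.sum_sub_distrib, Finset.smul_sum]
  refine Finset.sum_congr rfl fun a _ => ?_
  rw [gauge_covariance_summand d hLeib hComm, mul_smul_comm, smul_mul_assoc, ← smul_sub,
    smul_comm I, br]

end NC
end
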